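/- arXiv:2307.15969 — 2 statements merged into one kernel-verified Lean document; each statement's English description precedes it below -/
import Mathlib

section
/- Let G = (V,E,w) be a finite undirected graph with positive edge weights and N = |V| vertices, and run the LOWD iterative process from the equal-split initialization. For every t ∈ ℕ, if D_t ≠ ρ*, then D_{t+N} < D_t. -/
open Finset

noncomputable section

variable {V : Type*} [Fintype V] [DecidableEq V]

/-- Total weight `W(S)` of edges with both endpoints in `S`
(for a symmetric weight function with zero diagonal). -/
def wgt (w : V → V → ℝ) (S : Finset V) : ℝ := (∑ u ∈ S, ∑ v ∈ S, w u v) / 2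

/-- Density `ρ(S) = W(S)/|S|` of the subgraph induced by `S`. -/
def density (w : V → V → ℝ) (S : Finset V) : ℝ := wgt w S / S.card

/-- Weighted degree of `u` within `S`. -/
def wdeg (w : V → V → ℝ) (S : Finset V) (u : V) : ℝ := ∑ v ∈ S, w u v

/-- `f` is an edge-weight distribution for the weight function `w`:
`f u v` is the share of the weight of edge `{u,v}` assigned to `u`. -/
def IsDistrib (w f : V → V → ℝ) : Prop :=
  (∀ u v, 0 ≤ f u v) ∧ (∀ u v, f u v + f v u = w u v)

/-- Load `ℓ_v` of vertex `v` under the distribution `f`. -/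
def load (f : V → V → ℝ) (v : V) : ℝ := ∑ u, f v u

/-- Transfer `d` units of the weight of edge `{u,v}` from `u`'s share to `v`'s share. -/
def lowdTransfer (f : V → V → ℝ) (u v : V) (d : ℝ) : V → V → ℝ :=
  fun x y =>
    if x = u ∧ y = v then f u v - d
    else if x = v ∧ y = u then f v u + d
    else f x y

/-- The LOWD update on the edge `p = (u,v)`: with `ℓ_u ≥ ℓ_v`, transfer
`d = min{(ℓ_u − ℓ_v)/2, f_e(u)}` from `u`'s share to `v`'s share. -/
def lowdStep (f : V → V → ℝ) (p : V × V) : V → V → ℝ :=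
  if load f p.2 ≤ load f p.1 then
    lowdTransfer f p.1 p.2 (min ((load f p.1 - load f p.2) / 2) (f p.1 p.2))
  else
    lowdTransfer f p.2 p.1 (min ((load f p.2 - load f p.1) / 2) (f p.2 p.1))

/-- One LOWD iteration: process every edge of the list `es` once,
in the fixed order given by `es`, applying the update sequentially. -/
def lowdIter (es : List (V × V)) (f : V → V → ℝ) : V → V → ℝ :=
  es.foldl lowdStep f

/-- The LOWD iterative process started from the equal-split
initialization `f_e(u) = f_e(v) = w_e / 2`. -/
def lowdSeq (w : V → V → ℝ) (es : List (V × V)) (t : ℕ) : V → V → ℝ :=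
  (lowdIter es)^[t] (fun u v => w u v / 2)

/-- The list `es` enumerates each (undirected, loopless, positive-weight) edge of `w`
exactly once. -/
def EnumeratesEdges (w : V → V → ℝ) (es : List (V × V)) : Prop :=
  es.Nodup ∧
  (∀ p ∈ es, p.1 ≠ p.2 ∧ 0 < w p.1 p.2) ∧
  (∀ p ∈ es, (p.2, p.1) ∉ es) ∧
  (∀ u v : V, u ≠ v → 0 < w u v → (u, v) ∈ es ∨ (v, u) ∈ es)

/-- `D_t`: the maximum vertex load after `t` LOWD iterations. -/
def Dseq [Nonempty V] (w : V → V → ℝ) (es : List (V × V)) (t : ℕ) : ℝ :=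
  Finset.univ.sup' Finset.univ_nonempty (load (lowdSeq w es t))

lemma load_transfer (f : V → V → ℝ) (u v : V) (d : ℝ) (huv : u ≠ v) (x : V) :
    load (lowdTransfer f u v d) x
      = load f x + (if x = u then -d else 0) + (if x = v then d else 0) := by
  have key : ∀ y, lowdTransfer f u v d x y
      = f x y + (if y = v then (if x = u then -d else 0) else 0)
        + (if y = u then (if x = v then d else 0) else 0) := by
    intro y
    unfold lowdTransfer
    split_ifs <;> simp_all <;> ring
  unfold load
  simp only [key, Finset.sum_add_distrib, Finset.sum_ite_eq', Finset.mem_univ, if_true]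

lemma transfer_zero (f : V → V → ℝ) (u v : V) : lowdTransfer f u v 0 = f := by
  funext x y
  unfold lowdTransfer
  split_ifs <;> simp_all

lemma step_form (f : V → V → ℝ) (p : V × V) :
    ∃ u v : V, (p = (u, v) ∨ p = (v, u)) ∧ load f v ≤ load f u ∧
      lowdStep f p = lowdTransfer f u v (min ((load f u - load f v) / 2) (f u v)) := by
  unfold lowdStep
  by_cases h : load f p.2 ≤ load f p.1
  · exact ⟨p.1, p.2, Or.inl rfl, h, by rw [if_pos h]⟩
  · exact ⟨p.2, p.1, Or.inr rfl, (not_le.mp h).le, by rw [if_neg h]⟩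

lemma step_main (w f : V → V → ℝ) (hsymm : ∀ u v, w u v = w v u) (hf : IsDistrib w f) (M : ℝ)
    (hM : ∀ x, load f x ≤ M) (p : V × V) (hp : p.1 ≠ p.2) :
    IsDistrib w (lowdStep f p) ∧ (∀ x, load (lowdStep f p) x ≤ M) ∧
    (∀ x, load (lowdStep f p) x = M → load f x = M) ∧
    ((∀ x, load f x = M → load (lowdStep f p) x = M) →
      (∀ x, load f x = M → ∀ y, lowdStep f p x y = f x y) ∧
      (∀ x y, load f x = M → load f y ≠ M → (p = (x, y) ∨ p = (y, x)) → f x y = 0)) := by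
  obtain ⟨u, v, hpuv, hle, hstep⟩ := step_form f p
  have huv : u ≠ v := by
    rcases hpuv with h | h <;> subst h
    · exact hp
    · exact fun h => hp h.symm
  rw [hstep]
  obtain ⟨d, hd⟩ : ∃ d, d = min ((load f u - load f v) / 2) (f u v) := ⟨_, rfl⟩
  rw [← hd]
  have hd1 : d ≤ (load f u - load f v) / 2 := hd ▸ min_le_left _ _
  have hd2 : d ≤ f u v := hd ▸ min_le_right _ _
  have hd0 : 0 ≤ d := hd ▸ le_min (by linarith) (hf.1 u v)
  have hl := load_transfer f u v d huv
  have hMu := hM u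
  have hMv := hM v
  refine ⟨⟨?_, ?_⟩, ?_, ?_, ?_⟩
  · intro x y
    unfold lowdTransfer
    split_ifs
    · linarith
    · linarith [hf.1 v u]
    · exact hf.1 x y
  · intro x y
    have h1 := hf.2 x y
    have h2 := hf.2 u v
    have h3 := hsymm u v
    unfold lowdTransfer
    by_cases c1 : x = u ∧ y = v
    · obtain ⟨rfl, rfl⟩ := c1
      simp [huv]
      linarith
    · by_cases c2 : x = v ∧ y = u
      · obtain ⟨rfl, rfl⟩ := c2
        simp [huv]
        linarith
      · rw [if_neg c1, if_neg c2, if_neg (fun h => c2 ⟨h.2, h.1⟩),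
          if_neg (fun h => c1 ⟨h.2, h.1⟩)]
        exact h1
  · intro x
    rw [hl]
    have := hM x
    by_cases hxu : x = u
    · subst hxu; simp [huv]; linarith
    · by_cases hxv : x = v
      · subst hxv; simp [hxu]; linarith
      · simpa [hxu, hxv] using this
  · intro x hx
    rw [hl] at hx
    by_cases hxu : x = u
    · subst hxu; simp [huv] at hx; linarith
    · by_cases hxv : x = v
      · subst hxv; simp [hxu] at hx; linarith
      · simpa [hxu, hxv] using hx
  · intro hT
    by_cases hu : load f u = M
    · have h1 := hT u hu
      rw [hl] at h1
      simp [huv] at h1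
      have hdz : d = 0 := by linarith
      refine ⟨fun x _ y => by rw [hdz, transfer_zero], ?_⟩
      intro x y hx hy hxy
      have hyv : y = v ∧ x = u := by
        have : y ≠ u := fun h => hy (h ▸ hu)
        rcases hpuv with h | h <;> rcases hxy with h' | h' <;> rw [h] at h' <;>
          simp only [Prod.mk.injEq] at h' <;> grind
      obtain ⟨rfl, rfl⟩ := hyv
      have hlt : load f y < M := lt_of_le_of_ne hMv hy
      rw [hdz] at hd
      rcases min_choice ((load f x - load f y) / 2) (f x y) with h | h
      · linarith
      · linarith
    · have hv : load f v ≠ M := fun h => hu (by linarith)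
      refine ⟨fun x hx y => ?_, ?_⟩
      · have h1 : x ≠ u := fun h => hu (h ▸ hx)
        have h2 : x ≠ v := fun h => hv (h ▸ hx)
        simp [lowdTransfer, h1, h2]
      · intro x y hx hy hxy
        exfalso
        have h1 : x ≠ u := fun h => hu (h ▸ hx)
        have h2 : x ≠ v := fun h => hv (h ▸ hx)
        rcases hpuv with h | h <;> rcases hxy with h' | h' <;> rw [h] at h' <;>
          simp only [Prod.mk.injEq] at h' <;> grind

lemma iter_main (w : V → V → ℝ) (hsymm : ∀ u v, w u v = w v u) (M : ℝ) (l : List (V × V)) :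
    ∀ (f : V → V → ℝ), IsDistrib w f → (∀ x, load f x ≤ M) → (∀ p ∈ l, p.1 ≠ p.2) →
    IsDistrib w (lowdIter l f) ∧ (∀ x, load (lowdIter l f) x ≤ M) ∧
    (∀ x, load (lowdIter l f) x = M → load f x = M) ∧
    ((∀ x, load f x = M → load (lowdIter l f) x = M) →
      (∀ x y, load f x = M → load f y ≠ M → ((x, y) ∈ l ∨ (y, x) ∈ l) → f x y = 0)) := by
  induction l with
  | nil =>
    intro f hf hM _
    exact ⟨hf, hM, fun x h => h, fun _ x y _ _ h => by simp at h⟩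
  | cons p l ih =>
    intro f hf hM hl
    obtain ⟨a1, a2, a3, a4⟩ := step_main w f hsymm hf M hM p (hl p (by simp))
    obtain ⟨b1, b2, b3, b4⟩ := ih (lowdStep f p) a1 a2 (fun q hq => hl q (by simp [hq]))
    have e : lowdIter (p :: l) f = lowdIter l (lowdStep f p) := rfl
    rw [e]
    refine ⟨b1, b2, fun x hx => a3 x (b3 x hx), fun hT x y hx hy hxy => ?_⟩
    obtain ⟨c1, c2⟩ := a4 (fun x hx => b3 x (hT x hx))
    by_cases hp : p = (x, y) ∨ p = (y, x)
    · exact c2 x y hx hy hp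
    · rw [← c1 x hx y]
      refine b4 (fun x hx => hT x (a3 x hx)) x y (b3 x (hT x hx)) (fun h => hy (a3 y h)) ?_
      simp only [List.mem_cons] at hxy
      rcases hxy with (h | h) | (h | h)
      · exact absurd (Or.inl h.symm) hp
      · exact Or.inl h
      · exact absurd (Or.inr h.symm) hp
      · exact Or.inr h

lemma sum_distrib_inner (w f : V → V → ℝ) (hf : IsDistrib w f) (S : Finset V) :
    ∑ u ∈ S, ∑ v ∈ S, f u v = wgt w S := by
  have h : ∑ u ∈ S, ∑ v ∈ S, w u v
      = ∑ u ∈ S, ∑ v ∈ S, f u v + ∑ u ∈ S, ∑ v ∈ S, f v u := by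
    simp only [← Finset.sum_add_distrib, hf.2]
  rw [Finset.sum_comm (f := fun u v => f v u)] at h
  unfold wgt
  linarith

lemma density_le (w f : V → V → ℝ) (hf : IsDistrib w f) (M : ℝ) (hM : ∀ x, load f x ≤ M)
    (S : Finset V) (hS : S.Nonempty) : density w S ≤ M := by
  have hc : (0 : ℝ) < S.card := by exact_mod_cast hS.card_pos
  unfold density
  rw [div_le_iff₀ hc, ← sum_distrib_inner w f hf S]
  calc ∑ u ∈ S, ∑ v ∈ S, f u v ≤ ∑ u ∈ S, M := by
        refine Finset.sum_le_sum fun u _ => le_trans ?_ (hM u)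
        exact Finset.sum_le_sum_of_subset_of_nonneg (Finset.subset_univ S) fun v _ _ => hf.1 u v
    _ = M * S.card := by simp [mul_comm]

lemma density_eq (w f : V → V → ℝ) (hf : IsDistrib w f) (M : ℝ)
    (S : Finset V) (hS : S.Nonempty) (hM : ∀ x ∈ S, load f x = M)
    (h0 : ∀ x ∈ S, ∀ y ∉ S, f x y = 0) : density w S = M := by
  have hc : (0 : ℝ) < S.card := by exact_mod_cast hS.card_pos
  unfold density
  rw [div_eq_iff hc.ne', ← sum_distrib_inner w f hf S]
  calc ∑ u ∈ S, ∑ v ∈ S, f u v = ∑ u ∈ S, M := by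
        refine Finset.sum_congr rfl fun u hu => ?_
        rw [← hM u hu]
        exact Finset.sum_subset (Finset.subset_univ S) fun v _ hv => h0 u hu v hv
    _ = M * S.card := by simp [mul_comm]

/-- Running LOWD from the equal-split initialization on a finite
undirected graph with positive edge weights and `N = |V|` vertices: for every `t`,
if `D_t ≠ ρ*` then `D_{t+N} < D_t`. -/
theorem lowd_Dseq_strict_decrease
    [Nonempty V] (w : V → V → ℝ)
    (hsymm : ∀ u v, w u v = w v u)
    (hnonneg : ∀ u v, 0 ≤ w u v)
    (hdiag : ∀ v, w v v = 0)
    (es : List (V × V)) (hes : EnumeratesEdges w es)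
    (ρstar : ℝ)
    (hρ : IsGreatest {d : ℝ | ∃ S : Finset V, S.Nonempty ∧ density w S = d} ρstar) :
    ∀ t : ℕ, Dseq w es t ≠ ρstar → Dseq w es (t + Fintype.card V) < Dseq w es t := by
  intro t hne
  by_contra hlt
  rw [not_lt] at hlt
  obtain ⟨M, hMdef⟩ : ∃ M, M = Dseq w es t := ⟨_, rfl⟩
  rw [← hMdef] at hne hlt
  have hloop : ∀ p ∈ es, p.1 ≠ p.2 := fun p hp => (hes.2.1 p hp).1
  have hsucc : ∀ s, lowdSeq w es (s + 1) = lowdIter es (lowdSeq w es s) := fun s => by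
    unfold lowdSeq
    rw [Function.iterate_succ_apply']
  have hle : ∀ s x, load (lowdSeq w es s) x ≤ Dseq w es s := fun s x =>
    Finset.le_sup' (load (lowdSeq w es s)) (Finset.mem_univ x)
  have hdist : ∀ s, IsDistrib w (lowdSeq w es s) := by
    intro s
    induction s with
    | zero =>
      refine ⟨fun u v => ?_, fun u v => ?_⟩
      · exact div_nonneg (hnonneg u v) (by norm_num)
      · change w u v / 2 + w v u / 2 = w u v
        rw [hsymm v u]; ring
    | succ s ih =>
      rw [hsucc]
      exact (iter_main w hsymm _ es _ ih (hle s) hloop).1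
  have hbd : ∀ k x, load (lowdSeq w es (t + k)) x ≤ M := by
    intro k
    induction k with
    | zero => rw [hMdef]; exact hle t
    | succ k ih =>
      rw [← add_assoc, hsucc]
      exact (iter_main w hsymm M es _ (hdist _) ih hloop).2.1
  let T : ℕ → Finset V := fun k => Finset.univ.filter fun x => load (lowdSeq w es (t + k)) x = M
  have hTm : ∀ k x, x ∈ T k ↔ load (lowdSeq w es (t + k)) x = M := fun k x => by simp [T]
  have hsub : ∀ k, T (k + 1) ⊆ T k := by
    intro k x hx
    rw [hTm] at hx ⊢
    rw [← add_assoc, hsucc] at hx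
    exact (iter_main w hsymm M es _ (hdist _) (hbd k) hloop).2.2.1 x hx
  have hanti : Antitone T := antitone_nat_of_succ_le hsub
  have hlast : (T (Fintype.card V)).Nonempty := by
    obtain ⟨x, _, hx⟩ := Finset.exists_mem_eq_sup' Finset.univ_nonempty
      (load (lowdSeq w es (t + Fintype.card V)))
    refine ⟨x, (hTm _ _).2 (le_antisymm (hbd _ x) ?_)⟩
    rw [← hx]
    exact hlt
  have hex : ∃ k < Fintype.card V, T k ⊆ T (k + 1) := by
    by_contra hno
    push Not at hno
    have hcard : ∀ k, k ≤ Fintype.card V → (T k).card + k ≤ Fintype.card V := by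
      intro k
      induction k with
      | zero => intro _; exact Finset.card_le_univ _
      | succ k ih =>
        intro hk
        have h1 := ih (by omega)
        have h2 := Finset.card_lt_card (⟨hsub k, hno k (by omega)⟩ : T (k + 1) ⊂ T k)
        omega
    have := hcard _ le_rfl
    have := hlast.card_pos
    omega
  obtain ⟨k, hk, hTk⟩ := hex
  have hkey := (iter_main w hsymm M es _ (hdist _) (hbd k) hloop).2.2.2 (by
    intro x hx
    rw [← hsucc, add_assoc, ← hTm]
    exact hTk ((hTm _ _).2 hx))
  have hTne : (T k).Nonempty := hlast.mono (hanti hk.le)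
  have hdens : density w (T k) = M := by
    refine density_eq w _ (hdist (t + k)) M (T k) hTne (fun x hx => (hTm _ _).1 hx) ?_
    intro x hx y hy
    have hxy : x ≠ y := fun h => hy (h ▸ hx)
    rcases (hnonneg x y).lt_or_eq with hw | hw
    · exact hkey x y ((hTm _ _).1 hx) (fun h => hy ((hTm _ _).2 h)) (hes.2.2.2 x y hxy hw)
    · have h1 := (hdist (t + k)).2 x y
      have h2 := (hdist (t + k)).1 x y
      have h3 := (hdist (t + k)).1 y x
      linarith
  apply hne
  apply le_antisymm
  · exact hρ.2 ⟨T k, hTne, hdens⟩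
  · obtain ⟨S, hS, hSd⟩ := hρ.1
    rw [← hSd]
    exact density_le w _ (hdist (t + 0)) M (hbd 0) S hS
end
end

section
/- Let G = (V,E,w) be a finite undirected graph with positive edge weights and at least one edge. Then the minimum, over all edge-weight distributions f on G, of the maximum vertex load max_{v∈V} ℓ_v(f) equals ρ*, the maximum subgraph density. In particular, there exists an edge-weight distribution whose maximum vertex load equals ρ*, and every edge-weight distribution has maximum vertex load at least ρ* (strong duality for the densest subgraph LP). -/
open Finset

noncomputable section

variable {V : Type*} [Fintype V] [DecidableEq V]

lemma exists_min_distrib (w : V → V → ℝ) (hsymm : ∀ u v, w u v = w v u)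
    (hnonneg : ∀ u v, 0 ≤ w u v) :
    ∃ f, IsDistrib w f ∧ ∀ g, IsDistrib w g → ∑ x, load f x ^ 2 ≤ ∑ x, load g x ^ 2 := by
  have hc : IsCompact {f : V → V → ℝ | IsDistrib w f} := by
    refine (isCompact_Icc (a := (0 : V → V → ℝ)) (b := w)).of_isClosed_subset ?_ ?_
    · simp only [IsDistrib, Set.ofPred_and, Set.ofPred_forall]
      refine IsClosed.inter ?_ ?_
      · exact isClosed_iInter fun u => isClosed_iInter fun v =>
          isClosed_le continuous_const (by fun_prop)
      · exact isClosed_iInter fun u => isClosed_iInter fun v =>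
          isClosed_eq (by fun_prop) continuous_const
    · intro f hf
      refine ⟨fun u v => hf.1 u v, fun u v => ?_⟩
      have h1 := hf.2 u v
      have h2 := hf.1 v u
      linarith
  have hne : {f : V → V → ℝ | IsDistrib w f}.Nonempty := by
    refine ⟨fun u v => w u v / 2, fun u v => ?_, fun u v => ?_⟩
    · have := hnonneg u v
      positivity
    · have := hsymm u v
      simp only
      linarith
  obtain ⟨f, hf, hmin⟩ := hc.exists_isMinOn hne
    (f := fun f => ∑ x, load f x ^ 2) (by unfold load; fun_prop)
  exact ⟨f, hf, fun g hg => hmin hg⟩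

lemma min_distrib_le (w f : V → V → ℝ) (hf : IsDistrib w f)
    (hmin : ∀ g, IsDistrib w g → ∑ x, load f x ^ 2 ≤ ∑ x, load g x ^ 2)
    (u v : V) (huv : 0 < f u v) : load f u ≤ load f v := by
  by_contra! hlt
  have hne : u ≠ v := by
    rintro rfl
    exact lt_irrefl _ hlt
  obtain ⟨ε, hε0, hε1, hε2⟩ : ∃ ε : ℝ, 0 < ε ∧ ε ≤ f u v ∧ ε < load f u - load f v := by
    refine ⟨min (f u v) ((load f u - load f v) / 2), ?_, min_le_left _ _, ?_⟩
    · apply lt_min huv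
      linarith
    · refine (min_le_right _ _).trans_lt ?_
      linarith
  let g : V → V → ℝ := fun x y => f x y + (if x = v then (if y = u then ε else 0) else 0)
    - (if x = u then (if y = v then ε else 0) else 0)
  have hg : IsDistrib w g := by
    refine ⟨fun x y => ?_, fun x y => ?_⟩
    · have := hf.1 x y
      simp only [g]
      split_ifs <;> subst_vars <;> first | linarith | (exfalso; simp_all)
    · rw [← hf.2 x y]
      simp only [g]
      split_ifs <;> subst_vars <;> first | exact absurd rfl hne | ring1 | (exfalso; simp_all)
  have hl : ∀ x, load g x = load f x + (if x = v then ε else 0) - (if x = u then ε else 0) := by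
    intro x
    simp only [load, g, Finset.sum_sub_distrib, Finset.sum_add_distrib]
    congr 1
    · congr 1
      split_ifs <;> simp
    · split_ifs <;> simp
  have hsq : ∀ x, load g x ^ 2 = load f x ^ 2 + (if x = v then 2 * ε * load f v + ε ^ 2 else 0)
      - (if x = u then 2 * ε * load f u - ε ^ 2 else 0) := by
    intro x
    rw [hl]
    split_ifs <;> subst_vars <;> first | exact absurd rfl hne | ring1 | (exfalso; simp_all)
  have := hmin g hg
  simp only [hsq, Finset.sum_sub_distrib, Finset.sum_add_distrib, Finset.sum_ite_eq',
    Finset.mem_univ, if_true] at this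
  nlinarith [mul_pos hε0 (sub_pos.2 hε2)]

lemma wgt_eq (w f : V → V → ℝ) (hf : IsDistrib w f) (S : Finset V) :
    wgt w S = ∑ u ∈ S, ∑ v ∈ S, f u v := by
  have h : ∑ u ∈ S, ∑ v ∈ S, w u v = ∑ u ∈ S, ∑ v ∈ S, f u v + ∑ u ∈ S, ∑ v ∈ S, f u v := by
    have hcomm : ∑ u ∈ S, ∑ v ∈ S, f u v = ∑ u ∈ S, ∑ v ∈ S, f v u := Finset.sum_comm
    nth_rewrite 2 [hcomm]
    rw [← Finset.sum_add_distrib]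
    refine Finset.sum_congr rfl fun u _ => ?_
    rw [← Finset.sum_add_distrib]
    refine Finset.sum_congr rfl fun v _ => ?_
    rw [← hf.2 u v]
  unfold wgt
  rw [h]
  ring

lemma weak_dual [Nonempty V] (w f : V → V → ℝ) (hf : IsDistrib w f) (S : Finset V)
    (hS : S.Nonempty) :
    density w S ≤ Finset.univ.sup' Finset.univ_nonempty (load f) := by
  have hc : (0 : ℝ) < S.card := by exact_mod_cast hS.card_pos
  unfold density
  rw [div_le_iff₀ hc, wgt_eq w f hf S, mul_comm, ← nsmul_eq_mul]
  refine Finset.sum_le_card_nsmul _ _ _ fun u _ => ?_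
  refine le_trans ?_ (Finset.le_sup' (load f) (Finset.mem_univ u))
  exact Finset.sum_le_sum_of_subset_of_nonneg (Finset.subset_univ _) fun v _ _ => hf.1 u v

/-- strong duality for the densest subgraph LP. For a finite
undirected graph with positive edge weights and at least one edge, the minimum
over all edge-weight distributions `f` of the maximum vertex load equals `ρ*`:
some distribution attains maximum load `ρ*`, and every distribution has maximum
load at least `ρ*`. -/
theorem strong_duality_densest_subgraph
    [Nonempty V] (w : V → V → ℝ)
    (hsymm : ∀ u v, w u v = w v u)
    (hnonneg : ∀ u v, 0 ≤ w u v)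
    (hdiag : ∀ v, w v v = 0)
    (hedge : ∃ u v : V, 0 < w u v)
    (ρstar : ℝ)
    (hρ : IsGreatest {d : ℝ | ∃ S : Finset V, S.Nonempty ∧ density w S = d} ρstar) :
    IsLeast {D : ℝ | ∃ f : V → V → ℝ, IsDistrib w f ∧
        D = Finset.univ.sup' Finset.univ_nonempty (load f)} ρstar := by
  obtain ⟨⟨S₀, hS₀, hd₀⟩, hmax⟩ := hρ
  refine ⟨?_, ?_⟩
  · obtain ⟨f, hf, hmin⟩ := exists_min_distrib w hsymm hnonneg
    refine ⟨f, hf, le_antisymm (hd₀ ▸ weak_dual w f hf S₀ hS₀) ?_⟩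
    set M := Finset.univ.sup' Finset.univ_nonempty (load f) with hM
    obtain ⟨x, -, hx⟩ := Finset.exists_mem_eq_sup' Finset.univ_nonempty (load f)
    let S : Finset V := Finset.univ.filter fun v => load f v = M
    have hS : S.Nonempty := ⟨x, by simp [S, hM, hx]⟩
    have hc : (S.card : ℝ) ≠ 0 := by exact_mod_cast hS.card_pos.ne'
    refine hmax ⟨S, hS, ?_⟩
    unfold density
    rw [div_eq_iff hc, wgt_eq w f hf S, mul_comm, ← nsmul_eq_mul]
    refine Finset.sum_eq_card_nsmul fun u hu => ?_
    have hu' : load f u = M := (Finset.mem_filter.1 hu).2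
    rw [← hu']
    refine Finset.sum_subset (Finset.subset_univ _) fun v _ hv => ?_
    by_contra hne
    have hle := min_distrib_le w f hf hmin u v (lt_of_le_of_ne (hf.1 u v) (Ne.symm hne))
    refine hv (Finset.mem_filter.2 ⟨Finset.mem_univ v, le_antisymm ?_ (hu' ▸ hle)⟩)
    exact Finset.le_sup' (load f) (Finset.mem_univ v)
  · rintro D ⟨f, hf, rfl⟩
    exact hd₀ ▸ weak_dual w f hf S₀ hS₀
end
end
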